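/- Let θ ∈ [π, 2π) and let Ω ⊊ ℝ² be a nonempty open simply connected set satisfying the following exterior cone condition: for every y ∈ ∂Ω there exists a unit vector v ∈ ℝ² such that Ω ⊆ {x ∈ ℝ² : x ≠ y and ⟨x − y, v⟩ > |x − y| cos(θ/2)}, i.e. Ω is contained in an open infinite cone of opening angle θ with vertex y. Then for every u ∈ C_c^∞(Ω), ∫_Ω ‖∇u‖² dx ≥ (π²/(4θ²)) ∫_Ω u²/d² dx. -/

import Mathlib

open MeasureTheory Real
open scoped RealInnerProductSpace

open Set Metric Topology ComplexConjugate

/-- The disc automorphism `z ↦ (z - a) / (1 - conj a * z)`. -/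
noncomputable def mobius (a z : ℂ) : ℂ := (z - a) / (1 - conj a * z)

lemma mobius_denom_ne_zero {a z : ℂ} (ha : ‖a‖ < 1) (hz : ‖z‖ < 1) : 1 - conj a * z ≠ 0 := by
  intro h
  have h1 : ‖conj a * z‖ = 1 := by rw [← sub_eq_zero.mp h]; simp
  rw [norm_mul, RCLike.norm_conj] at h1
  nlinarith [norm_nonneg a, norm_nonneg z]

lemma one_sub_norm_mobius_sq {a z : ℂ} (ha : ‖a‖ < 1) (hz : ‖z‖ < 1) :
    1 - ‖mobius a z‖ ^ 2 =
      (1 - ‖a‖ ^ 2) * (1 - ‖z‖ ^ 2) / ‖1 - conj a * z‖ ^ 2 := by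
  have h0 : ‖1 - conj a * z‖ ^ 2 ≠ 0 := by
    simpa using mobius_denom_ne_zero ha hz
  rw [mobius, norm_div, div_pow, eq_div_iff h0, sub_mul, div_mul_cancel₀ _ h0]
  simp only [← Complex.normSq_eq_norm_sq, Complex.normSq_apply]
  simp
  ring

lemma norm_mobius_lt_one {a z : ℂ} (ha : ‖a‖ < 1) (hz : ‖z‖ < 1) : ‖mobius a z‖ < 1 := by
  have h0 : 0 < ‖1 - conj a * z‖ ^ 2 := by
    have := mobius_denom_ne_zero ha hz
    positivity
  have h := one_sub_norm_mobius_sq ha hz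
  have h2 : 0 < (1 - ‖a‖ ^ 2) * (1 - ‖z‖ ^ 2) / ‖1 - conj a * z‖ ^ 2 := by
    have h3 : 0 < 1 - ‖a‖ ^ 2 := by nlinarith [norm_nonneg a]
    have h4 : 0 < 1 - ‖z‖ ^ 2 := by nlinarith [norm_nonneg z]
    positivity
  nlinarith [norm_nonneg (mobius a z)]

lemma hasDerivAt_mobius {a z : ℂ} (ha : ‖a‖ < 1) (hz : ‖z‖ < 1) :
    HasDerivAt (mobius a) ((1 - ‖a‖ ^ 2) / (1 - conj a * z) ^ 2) z := by
  have h := ((hasDerivAt_id z).sub_const a).div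
    (((hasDerivAt_id z).const_mul (conj a)).const_sub 1) (mobius_denom_ne_zero ha hz)
  refine h.congr_deriv ?_
  congr 1
  have : (‖a‖ : ℂ) ^ 2 = conj a * a := (Complex.conj_mul' a).symm
  rw [this]
  simp
  ring

lemma mobius_self (a : ℂ) : mobius a a = 0 := by simp [mobius]

lemma injOn_mobius {a : ℂ} (ha : ‖a‖ < 1) : InjOn (mobius a) (ball 0 1) := by
  intro z hz w hw h
  rw [mem_ball_zero_iff] at hz hw
  rw [mobius, mobius, div_eq_div_iff (mobius_denom_ne_zero ha hz) (mobius_denom_ne_zero ha hw)] at h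
  have h1 : (1 - conj a * a) * (z - w) = 0 := by linear_combination h
  rcases mul_eq_zero.mp h1 with h2 | h2
  · exact absurd h2 (mobius_denom_ne_zero ha ha)
  · exact sub_eq_zero.mp h2

lemma differentiableOn_mobius {a : ℂ} (ha : ‖a‖ < 1) :
    DifferentiableOn ℂ (mobius a) (ball 0 1) := fun _ hz ↦
  (hasDerivAt_mobius ha (mem_ball_zero_iff.mp hz)).differentiableAt.differentiableWithinAt

lemma mapsTo_mobius {a : ℂ} (ha : ‖a‖ < 1) : MapsTo (mobius a) (ball 0 1) (ball 0 1) :=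
  fun _ hz ↦ mem_ball_zero_iff.mpr (norm_mobius_lt_one ha (mem_ball_zero_iff.mp hz))

/-- Injective holomorphic immersions of `Ω` into the unit disc. -/
structure DiscEmbedding (Ω : Set ℂ) (f : ℂ → ℂ) : Prop where
  differentiableOn : DifferentiableOn ℂ f Ω
  mapsTo : MapsTo f Ω (ball 0 1)
  injOn : InjOn f Ω
  deriv_ne_zero : ∀ z ∈ Ω, deriv f z ≠ 0

namespace DiscEmbedding

variable {Ω : Set ℂ} {f : ℂ → ℂ}

lemma norm_lt_one (hf : DiscEmbedding Ω f) {z : ℂ} (hz : z ∈ Ω) : ‖f z‖ < 1 :=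
  mem_ball_zero_iff.mp (hf.mapsTo hz)

lemma hasDerivAt (hf : DiscEmbedding Ω f) (hΩ : IsOpen Ω) {z : ℂ} (hz : z ∈ Ω) :
    HasDerivAt f (deriv f z) z :=
  (hf.differentiableOn.differentiableAt (hΩ.mem_nhds hz)).hasDerivAt

lemma hasDerivAt_mobius_comp (hf : DiscEmbedding Ω f) (hΩ : IsOpen Ω) {a : ℂ} (ha : ‖a‖ < 1)
    {z : ℂ} (hz : z ∈ Ω) :
    HasDerivAt (mobius a ∘ f) ((1 - ‖a‖ ^ 2) / (1 - conj a * f z) ^ 2 * deriv f z) z :=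
  (hasDerivAt_mobius ha (hf.norm_lt_one hz)).comp z (hf.hasDerivAt hΩ hz)

lemma mobius_comp (hf : DiscEmbedding Ω f) (hΩ : IsOpen Ω) {a : ℂ} (ha : ‖a‖ < 1) :
    DiscEmbedding Ω (mobius a ∘ f) where
  differentiableOn := (differentiableOn_mobius ha).comp hf.differentiableOn hf.mapsTo
  mapsTo := (mapsTo_mobius ha).comp hf.mapsTo
  injOn := (injOn_mobius ha).comp hf.injOn hf.mapsTo
  deriv_ne_zero z hz := by
    rw [(hf.hasDerivAt_mobius_comp hΩ ha hz).deriv]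
    refine mul_ne_zero (div_ne_zero ?_ (pow_ne_zero _
      (mobius_denom_ne_zero ha (hf.norm_lt_one hz)))) (hf.deriv_ne_zero z hz)
    rw [← Complex.conj_mul']
    exact mobius_denom_ne_zero ha ha

lemma norm_deriv_le_inv (hf : DiscEmbedding Ω f) {x : ℂ} {r : ℝ} (hr : 0 < r)
    (hball : ball x r ⊆ Ω) (hx : f x = 0) : ‖deriv f x‖ ≤ 1 / r := by
  refine Complex.norm_deriv_le_div_of_mapsTo_ball (hf.differentiableOn.mono hball) ?_ hr
  rw [hx]
  exact (hf.mapsTo.mono_left hball).mono_right ball_subset_closedBall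

/-- If `f` omits a point `a` of the disc, a square root of `f` followed by automorphisms has
larger derivative at the base point. -/
lemma exists_deriv_eq_of_notMem_image (hf : DiscEmbedding Ω f) (hΩ : IsOpen Ω)
    (hsc : IsSimplyConnected Ω) {x a : ℂ} (hx : x ∈ Ω) (hfx : f x = 0) (ha : ‖a‖ < 1)
    (haf : a ∉ f '' Ω) :
    ∃ h, DiscEmbedding Ω h ∧ h x = 0 ∧
      ‖deriv h x‖ * (2 * √‖a‖) = (1 + ‖a‖) * ‖deriv f x‖ := by
  set p := mobius a ∘ f with hp
  have hpe : DiscEmbedding Ω p := hf.mobius_comp hΩ ha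
  have hp0 : ∀ z ∈ Ω, p z ≠ 0 := by
    intro z hz h
    rw [hp, Function.comp_apply, mobius, div_eq_zero_iff] at h
    rcases h with h | h
    · exact haf ⟨z, hz, sub_eq_zero.mp h⟩
    · exact mobius_denom_ne_zero ha (hf.norm_lt_one hz) h
  obtain ⟨g, hgc, hg⟩ := Complex.exists_continuousOn_pow_eq hsc hΩ
    hpe.differentiableOn.continuousOn (by rintro ⟨z, hz, h⟩; exact hp0 z hz h) two_ne_zero
  have hg0 : ∀ z ∈ Ω, g z ≠ 0 := fun z hz h ↦ hp0 z hz (by rw [← hg, h]; simp)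
  have hgn : ∀ z, ‖g z‖ ^ 2 = ‖p z‖ := fun z ↦ by rw [← hg, norm_pow]
  have hg1 : ∀ z ∈ Ω, ‖g z‖ < 1 := fun z hz ↦ by
    have := hgn z
    nlinarith [hpe.norm_lt_one hz, norm_nonneg (g z)]
  have hgd : ∀ z ∈ Ω, HasDerivAt g (deriv p z / (2 * g z)) z := by
    intro z hz
    have hsq : HasStrictDerivAt (fun w : ℂ ↦ w ^ 2) (2 * g z) (g z) := by
      simpa using hasStrictDerivAt_pow 2 (g z)
    have hne : (2 * g z) ≠ 0 := mul_ne_zero two_ne_zero (hg0 z hz)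
    have hl := hsq.to_localInverse hne
    have hl' : HasDerivAt (hsq.localInverse _ _ _ hne) (2 * g z)⁻¹ (p z) := by
      have := hl.hasDerivAt
      rwa [hg] at this
    have hcomp := hl'.comp z (hpe.hasDerivAt hΩ hz)
    have hev : g =ᶠ[𝓝 z] (hsq.localInverse _ _ _ hne) ∘ p := by
      have h1 := (hsq.hasStrictFDerivAt_equiv hne).eventually_left_inverse
      have h2 := (hgc.continuousAt (hΩ.mem_nhds hz)).eventually h1
      filter_upwards [h2] with w hw
      rw [Function.comp_apply, ← hg]
      exact hw.symm
    refine (hcomp.congr_of_eventuallyEq hev).congr_deriv ?_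
    rw [div_eq_mul_inv, mul_comm]
  have hge : DiscEmbedding Ω g := {
    differentiableOn := fun z hz ↦ (hgd z hz).differentiableAt.differentiableWithinAt
    mapsTo := fun z hz ↦ mem_ball_zero_iff.mpr (hg1 z hz)
    injOn := fun z hz w hw h ↦ hpe.injOn hz hw (by rw [← hg, ← hg, h])
    deriv_ne_zero := fun z hz ↦ by
      rw [(hgd z hz).deriv]
      exact div_ne_zero (hpe.deriv_ne_zero z hz) (mul_ne_zero two_ne_zero (hg0 z hz)) }
  refine ⟨mobius (g x) ∘ g, hge.mobius_comp hΩ (hg1 x hx), mobius_self _, ?_⟩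
  have hpx : ‖p x‖ = ‖a‖ := by simp [hp, hfx, mobius]
  have hgx : ‖g x‖ ^ 2 = ‖a‖ := by rw [hgn, hpx]
  have hgx' : ‖g x‖ = √‖a‖ := by rw [← hgx, Real.sqrt_sq (norm_nonneg _)]
  have hd1 : ‖deriv p x‖ = (1 - ‖a‖ ^ 2) * ‖deriv f x‖ := by
    rw [(hf.hasDerivAt_mobius_comp hΩ ha hx).deriv, hfx, norm_mul]
    congr 1
    have : (1 - (‖a‖ : ℂ) ^ 2) = ((1 - ‖a‖ ^ 2 : ℝ) : ℂ) := by push_cast; rfl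
    simp only [mul_zero, sub_zero, one_pow, div_one]
    rw [this, Complex.norm_real, Real.norm_of_nonneg]
    nlinarith [norm_nonneg a]
  have hd2 : ‖deriv (mobius (g x) ∘ g) x‖ = ‖deriv p x‖ / (2 * √‖a‖) / (1 - ‖a‖) := by
    rw [(hge.hasDerivAt_mobius_comp hΩ (hg1 x hx) hx).deriv, (hgd x hx).deriv, Complex.conj_mul',
      norm_mul, norm_div, norm_div, norm_mul, norm_pow]
    have : (1 - (‖g x‖ : ℂ) ^ 2) = ((1 - ‖a‖ : ℝ) : ℂ) := by rw [← hgx]; push_cast; rfl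
    rw [this, Complex.norm_real, Real.norm_of_nonneg (by linarith), hgx']
    have : 1 - ‖a‖ ≠ 0 := by linarith
    rw [Complex.norm_ofNat]
    field_simp
  have hane : a ≠ 0 := by
    rintro rfl
    exact haf ⟨x, hx, hfx⟩
  have : 0 < √‖a‖ := Real.sqrt_pos.mpr (norm_pos_iff.mpr hane)
  have h1 : 1 - ‖a‖ ≠ 0 := by linarith
  rw [hd2, hd1]
  field_simp
  ring

/-- Embeddings with nearly maximal derivative at a base point nearly cover the disc. -/
lemma exists_ball_subset_image (hf : DiscEmbedding Ω f) (hΩ : IsOpen Ω)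
    (hsc : IsSimplyConnected Ω) {x : ℂ} (hx : x ∈ Ω) {R : ℝ} (hR0 : 0 < R) (hR1 : R < 1) :
    ∃ h, DiscEmbedding Ω h ∧ h x = 0 ∧ ball 0 R ⊆ h '' Ω := by
  set S : Set ℝ := {t | ∃ h, DiscEmbedding Ω h ∧ h x = 0 ∧ ‖deriv h x‖ = t} with hS
  obtain ⟨r, hr, hball⟩ := Metric.isOpen_iff.mp hΩ x hx
  have hbdd : BddAbove S := ⟨1 / r, by
    rintro _ ⟨h, hh, hh0, rfl⟩
    exact hh.norm_deriv_le_inv hr hball hh0⟩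
  have hmem : ‖deriv (mobius (f x) ∘ f) x‖ ∈ S :=
    ⟨_, hf.mobius_comp hΩ (hf.norm_lt_one hx), mobius_self _, rfl⟩
  have hpos : 0 < sSup S := lt_of_lt_of_le
    (norm_pos_iff.mpr ((hf.mobius_comp hΩ (hf.norm_lt_one hx)).deriv_ne_zero x hx))
    (le_csSup hbdd hmem)
  have hκ : sSup S * (2 * √R / (1 + R)) < sSup S := by
    refine mul_lt_of_lt_one_right hpos ?_
    rw [div_lt_one (by linarith)]
    nlinarith [Real.sq_sqrt hR0.le, sq_pos_of_pos (show 0 < 1 - √R by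
      rw [sub_pos, Real.sqrt_lt' one_pos]; simpa using hR1)]
  obtain ⟨_, ⟨h, hh, hh0, rfl⟩, hlt⟩ := exists_lt_of_lt_csSup ⟨_, hmem⟩ hκ
  refine ⟨h, hh, hh0, fun a ha ↦ ?_⟩
  rw [mem_ball_zero_iff] at ha
  by_contra hna
  obtain ⟨k, hk, hk0, hkd⟩ := hh.exists_deriv_eq_of_notMem_image hΩ hsc hx hh0 (ha.trans hR1) hna
  have hkS : ‖deriv k x‖ ≤ sSup S := le_csSup hbdd ⟨k, hk, hk0, rfl⟩
  have hs : √‖a‖ ≤ √R := Real.sqrt_le_sqrt ha.le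
  have hs0 : 0 ≤ √‖a‖ := Real.sqrt_nonneg _
  have hs1 : √R < 1 := by rw [Real.sqrt_lt' one_pos]; simpa using hR1
  have e1 : √‖a‖ ^ 2 = ‖a‖ := Real.sq_sqrt (norm_nonneg _)
  have e2 : √R ^ 2 = R := Real.sq_sqrt hR0.le
  have hcmp : 2 * √‖a‖ * (1 + R) ≤ 2 * √R * (1 + ‖a‖) := by
    have hprod : √‖a‖ * √R ≤ 1 := by nlinarith
    have : 0 ≤ (√R - √‖a‖) * (1 - √‖a‖ * √R) :=
      mul_nonneg (sub_nonneg.mpr hs) (sub_nonneg.mpr hprod)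
    nlinarith
  rw [← mul_div_assoc, div_lt_iff₀ (by linarith)] at hlt
  have h1 : ‖deriv k x‖ * (2 * √‖a‖) ≤ sSup S * (2 * √‖a‖) :=
    mul_le_mul_of_nonneg_right hkS (by positivity)
  have h2 : (1 + ‖a‖) * (sSup S * (2 * √R)) < (1 + ‖a‖) * (‖deriv h x‖ * (1 + R)) :=
    mul_lt_mul_of_pos_left hlt (by positivity)
  have h3 : sSup S * (2 * √‖a‖ * (1 + R)) ≤ sSup S * (2 * √R * (1 + ‖a‖)) :=
    mul_le_mul_of_nonneg_left hcmp hpos.le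
  nlinarith

/-- Comparison of derivatives: a map that nearly covers the disc has nearly the largest
derivative, in the hyperbolic sense, among holomorphic maps into the disc. -/
lemma norm_deriv_le_of_ball_subset_image (hf : DiscEmbedding Ω f) (hΩ : IsOpen Ω) {R : ℝ}
    (hR : 0 < R) (hball : ball 0 R ⊆ f '' Ω) {k : ℂ → ℂ} (hk : DifferentiableOn ℂ k Ω)
    (hkm : MapsTo k Ω (ball 0 1)) {x : ℂ} (hx : x ∈ Ω) (hkx : k x = 0) (hfx : ‖f x‖ < R) :
    ‖deriv k x‖ * (R ^ 2 - ‖f x‖ ^ 2) ≤ ‖deriv f x‖ * R := by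
  have hex : ∀ w : ℂ, w ∈ ball (0 : ℂ) R → ∃ z, z ∈ Ω ∧ f z = w := fun w hw ↦ hball hw
  choose! g hgΩ hg using hex
  have hgf : ∀ z ∈ Ω, ‖f z‖ < R → g (f z) = z := fun z hz hz' ↦
    hf.injOn (hgΩ _ (mem_ball_zero_iff.mpr hz')) hz (hg _ (mem_ball_zero_iff.mpr hz'))
  have hgd : ∀ w ∈ ball (0 : ℂ) R, HasDerivAt g (deriv f (g w))⁻¹ w := by
    intro w hw
    have hz := hgΩ w hw
    have hst : HasStrictDerivAt f (deriv f (g w)) (g w) :=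
      ((hf.differentiableOn.analyticAt (hΩ.mem_nhds hz)).contDiffAt
        (n := 1)).hasStrictDerivAt one_ne_zero
    have hne := hf.deriv_ne_zero _ hz
    have hl := (hst.to_localInverse hne).hasDerivAt
    rw [hg w hw] at hl
    have hst' := hst.hasStrictFDerivAt_equiv hne
    refine hl.congr_of_eventuallyEq ?_
    have h1 := hst'.eventually_right_inverse
    have h2 := hst'.localInverse_tendsto.eventually (hΩ.mem_nhds hz)
    rw [hg w hw] at h1 h2
    filter_upwards [h1, h2, isOpen_ball.mem_nhds hw] with ζ h1 h2 h3
    exact hf.injOn (hgΩ _ h3) h2 ((hg _ h3).trans h1.symm)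
  set b : ℂ := f x / R with hb
  have hbn : ‖-b‖ < 1 := by
    rw [norm_neg, hb, norm_div, Complex.norm_real, Real.norm_of_nonneg hR.le]
    exact (div_lt_one hR).mpr hfx
  set m : ℂ → ℂ := fun ζ ↦ R * mobius (-b) ζ with hm
  have hmR : MapsTo m (ball 0 1) (ball 0 R) := by
    intro ζ hζ
    rw [mem_ball_zero_iff] at hζ ⊢
    rw [hm, norm_mul, Complex.norm_real, Real.norm_of_nonneg hR.le]
    exact mul_lt_of_lt_one_right hR (norm_mobius_lt_one hbn hζ)
  have hm0 : m 0 = f x := by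
    have : (R : ℂ) ≠ 0 := by exact_mod_cast hR.ne'
    simp [hm, mobius, hb]
    field_simp
  have hmd : HasDerivAt m (R * (1 - ‖b‖ ^ 2)) 0 := by
    have := (hasDerivAt_mobius hbn (z := 0) (by simp)).const_mul (R : ℂ)
    simpa using this
  have hmdiff : DifferentiableOn ℂ m (ball 0 1) := (differentiableOn_mobius hbn).const_mul _
  have hgdiff : DifferentiableOn ℂ g (ball 0 R) := fun w hw ↦
    (hgd w hw).differentiableAt.differentiableWithinAt
  have hgx : g (f x) = x := hgf x hx hfx
  set q := k ∘ g ∘ m with hq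
  have hqd : DifferentiableOn ℂ q (ball 0 1) := hk.comp (hgdiff.comp hmdiff hmR)
    (MapsTo.comp (fun _ h ↦ hgΩ _ h) hmR)
  have hqm : MapsTo q (ball 0 1) (ball 0 1) :=
    hkm.comp (MapsTo.comp (fun _ h ↦ hgΩ _ h) hmR)
  have hq0 : q 0 = 0 := by simp [hq, hm0, hgx, hkx]
  have hle : ‖deriv q 0‖ ≤ 1 / 1 :=
    Complex.norm_deriv_le_div_of_mapsTo_ball hqd
      (by rw [hq0]; exact hqm.mono_right ball_subset_closedBall) one_pos
  have hgd0 : HasDerivAt g (deriv f x)⁻¹ (m 0) := by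
    have := hgd (f x) (mem_ball_zero_iff.mpr hfx)
    rwa [hgx, ← hm0] at this
  have hkd : HasDerivAt k (deriv k x) (g (m 0)) := by
    rw [hm0, hgx]
    exact (hk.differentiableAt (hΩ.mem_nhds hx)).hasDerivAt
  have hqder : HasDerivAt q (deriv k x * ((deriv f x)⁻¹ * (R * (1 - ‖b‖ ^ 2)))) 0 :=
    hkd.comp 0 (hgd0.comp 0 hmd)
  have hbn2 : ‖b‖ = ‖f x‖ / R := by
    rw [hb, norm_div, Complex.norm_real, Real.norm_of_nonneg hR.le]
  have hb1 : ‖b‖ < 1 := by simpa using hbn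
  have hcast : (R * (1 - ‖b‖ ^ 2) : ℂ) = ((R * (1 - ‖b‖ ^ 2) : ℝ) : ℂ) := by push_cast; rfl
  have hf0 : 0 < ‖deriv f x‖ := norm_pos_iff.mpr (hf.deriv_ne_zero x hx)
  rw [hqder.deriv, hcast, norm_mul, norm_mul, norm_inv, Complex.norm_real, Real.norm_of_nonneg
    (mul_nonneg hR.le (by nlinarith [norm_nonneg b])), hbn2] at hle
  have e : ‖deriv k x‖ * (‖deriv f x‖⁻¹ * (R * (1 - (‖f x‖ / R) ^ 2))) =
      ‖deriv k x‖ * (R ^ 2 - ‖f x‖ ^ 2) / (‖deriv f x‖ * R) := by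
    field_simp
  rw [e, div_one, div_le_one (by positivity)] at hle
  exact hle

end DiscEmbedding

/-- A crude form of Harnack's inequality for holomorphic maps into the disc. -/
lemma one_sub_norm_le_of_mapsTo_ball {f : ℂ → ℂ} {y z : ℂ} {r : ℝ} (hr : 0 < r)
    (hd : DifferentiableOn ℂ f (ball y r)) (hm : MapsTo f (ball y r) (ball 0 1))
    (hz : dist z y < r / 2) : 3 / 16 * (1 - ‖f y‖) ≤ 1 - ‖f z‖ := by
  have hfy : ‖f y‖ < 1 := mem_ball_zero_iff.mp (hm (mem_ball_self hr))
  have hzr : z ∈ ball y r := mem_ball.mpr (by linarith)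
  have hfz : ‖f z‖ < 1 := mem_ball_zero_iff.mp (hm hzr)
  have h := Complex.dist_le_div_mul_dist_of_mapsTo_ball
    ((differentiableOn_mobius hfy).comp hd hm) (c := y) (R₁ := r) (R₂ := 1)
    (by
      rw [Function.comp_apply, mobius_self]
      exact ((mapsTo_mobius hfy).comp hm).mono_right ball_subset_closedBall) hzr
  rw [Function.comp_apply, Function.comp_apply, mobius_self, dist_zero_right] at h
  have h2 : ‖mobius (f y) (f z)‖ ≤ 1 / 2 := by
    refine h.trans ?_
    rw [div_mul_eq_mul_div, div_le_iff₀ hr]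
    linarith
  have h3 := one_sub_norm_mobius_sq hfy hfz
  have hden : 1 - ‖f y‖ ≤ ‖1 - conj (f y) * f z‖ := by
    have h4 := norm_sub_norm_le (1 : ℂ) (conj (f y) * f z)
    rw [norm_one, norm_mul, RCLike.norm_conj] at h4
    nlinarith [norm_nonneg (f y), norm_nonneg (f z)]
  have hden0 : 0 < ‖1 - conj (f y) * f z‖ ^ 2 := by
    have : 0 < ‖1 - conj (f y) * f z‖ := by linarith
    positivity
  rw [eq_div_iff hden0.ne'] at h3
  have h5 : 3 / 4 * (1 - ‖f y‖) ^ 2 ≤ (1 - ‖f y‖ ^ 2) * (1 - ‖f z‖ ^ 2) := by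
    rw [← h3]
    have h6 : (1 - ‖f y‖) ^ 2 ≤ ‖1 - conj (f y) * f z‖ ^ 2 := by
      have : 0 ≤ 1 - ‖f y‖ := by linarith
      gcongr
    have h7 : 3 / 4 ≤ 1 - ‖mobius (f y) (f z)‖ ^ 2 := by
      nlinarith [norm_nonneg (mobius (f y) (f z))]
    nlinarith [sq_nonneg (1 - ‖f y‖)]
  have h8 : (1 - ‖f y‖) * (3 / 4 * (1 - ‖f y‖)) ≤
      (1 - ‖f y‖) * ((1 + ‖f y‖) * (1 - ‖f z‖ ^ 2)) := by nlinarith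
  have h9 := le_of_mul_le_mul_left h8 (by linarith)
  nlinarith [norm_nonneg (f y), norm_nonneg (f z),
    mul_nonneg (norm_nonneg (f y)) (norm_nonneg (f z)), mul_pos (sub_pos.mpr hfy) (sub_pos.mpr hfz),
    mul_nonneg (sub_pos.mpr hfy).le (sq_nonneg (1 - ‖f z‖)), sq_nonneg (1 - ‖f z‖)]

/-- Holomorphic maps into the disc that vanish at a base point stay uniformly away from the
unit circle on compact sets. -/
lemma exists_forall_norm_le_of_isCompact {Ω K : Set ℂ} (hΩ : IsOpen Ω) (hc : IsPreconnected Ω)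
    {x₀ : ℂ} (hx₀ : x₀ ∈ Ω) (hK : IsCompact K) (hKΩ : K ⊆ Ω) :
    ∃ δ > 0, ∀ f : ℂ → ℂ, DifferentiableOn ℂ f Ω → MapsTo f Ω (ball 0 1) → f x₀ = 0 →
      ∀ x ∈ K, δ ≤ 1 - ‖f x‖ := by
  let U : Set ℂ := {x | x ∈ Ω ∧ ∃ δ > 0, ∀ f : ℂ → ℂ, DifferentiableOn ℂ f Ω →
    MapsTo f Ω (ball 0 1) → f x₀ = 0 → δ ≤ 1 - ‖f x‖}
  have hloc : ∀ x ∈ U, ∃ t ∈ 𝓝 x, t ⊆ Ω ∧ ∃ δ > 0, ∀ f : ℂ → ℂ, DifferentiableOn ℂ f Ω →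
      MapsTo f Ω (ball 0 1) → f x₀ = 0 → ∀ z ∈ t, δ ≤ 1 - ‖f z‖ := by
    rintro x ⟨hx, δ, hδ, h⟩
    obtain ⟨r, hr, hball⟩ := Metric.isOpen_iff.mp hΩ x hx
    refine ⟨ball x (r / 2), ball_mem_nhds x (half_pos hr),
      (ball_subset_ball (by linarith)).trans hball, 3 / 16 * δ, by positivity, ?_⟩
    intro f hf hfm hf0 z hz
    have h1 := one_sub_norm_le_of_mapsTo_ball hr (hf.mono hball) (hfm.mono_left hball) hz
    linarith [h f hf hfm hf0]
  have hUo : IsOpen U := by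
    rw [isOpen_iff_mem_nhds]
    intro x hx
    obtain ⟨t, ht, htΩ, δ, hδ, h⟩ := hloc x hx
    filter_upwards [ht] with z hz
    exact ⟨htΩ hz, δ, hδ, fun f h1 h2 h3 ↦ h f h1 h2 h3 z hz⟩
  have hx₀U : x₀ ∈ U := ⟨hx₀, 1, one_pos, fun f _ _ h ↦ by simp [h]⟩
  have hsub : Ω ⊆ U := by
    refine hc.subset_of_closure_inter_subset hUo ⟨x₀, hx₀, hx₀U⟩ ?_
    rintro x ⟨hxU, hx⟩
    obtain ⟨r, hr, hball⟩ := Metric.isOpen_iff.mp hΩ x hx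
    obtain ⟨y, ⟨hy, δ, hδ, h⟩, hxy⟩ := Metric.mem_closure_iff.mp hxU (r / 4) (by positivity)
    have hb : ball y (r / 2) ⊆ Ω := (ball_subset_ball' (by
      rw [dist_comm]; linarith)).trans hball
    refine ⟨hx, 3 / 16 * δ, by positivity, fun f hf hfm hf0 ↦ ?_⟩
    have h1 := one_sub_norm_le_of_mapsTo_ball (z := x) (half_pos hr) (hf.mono hb)
      (hfm.mono_left hb) (by linarith)
    linarith [h f hf hfm hf0]
  refine hK.induction_on (p := fun t ↦ ∃ δ > 0, ∀ f : ℂ → ℂ, DifferentiableOn ℂ f Ω →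
    MapsTo f Ω (ball 0 1) → f x₀ = 0 → ∀ x ∈ t, δ ≤ 1 - ‖f x‖) ⟨1, one_pos, by simp⟩ ?_ ?_ ?_
  · rintro s t hst ⟨δ, hδ, h⟩
    exact ⟨δ, hδ, fun f h1 h2 h3 x hx ↦ h f h1 h2 h3 x (hst hx)⟩
  · rintro s t ⟨δ, hδ, h⟩ ⟨δ', hδ', h'⟩
    refine ⟨min δ δ', lt_min hδ hδ', ?_⟩
    rintro f h1 h2 h3 x (hx | hx)
    · exact (min_le_left _ _).trans (h f h1 h2 h3 x hx)
    · exact (min_le_right _ _).trans (h' f h1 h2 h3 x hx)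
  · intro x hx
    obtain ⟨t, ht, -, h⟩ := hloc x (hsub (hKΩ hx))
    exact ⟨t, mem_nhdsWithin_of_mem_nhds ht, h⟩

/-- The open cone in `ℂ` with vertex `y`, axis `v` and opening angle `θ`. -/
def planeCone (θ : ℝ) (y v : ℂ) : Set ℂ :=
  {z | z ≠ y ∧ ‖z - y‖ * Real.cos (θ / 2) < ((z - y) * conj v).re}

lemma abs_arg_lt_of_mem_planeCone {θ : ℝ} (hθ₀ : 0 < θ) {y v z : ℂ}
    (hv : ‖v‖ = 1) (hz : z ∈ planeCone θ y v) :
    (z - y) * conj v ≠ 0 ∧ |((z - y) * conj v).arg| < θ / 2 := by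
  obtain ⟨hzy, hz⟩ := hz
  set ζ := (z - y) * conj v with hζ
  have hn : ‖z - y‖ = ‖ζ‖ := by rw [hζ, norm_mul, RCLike.norm_conj, hv, mul_one]
  have hζ0 : ζ ≠ 0 := by
    rw [← norm_ne_zero_iff, ← hn, norm_ne_zero_iff]
    exact sub_ne_zero.mpr hzy
  refine ⟨hζ0, ?_⟩
  by_contra! hle
  have hcos := Real.cos_le_cos_of_nonneg_of_le_pi (by positivity) (Complex.abs_arg_le_pi ζ) hle
  rw [Real.cos_abs] at hcos
  rw [hn, ← Complex.norm_mul_cos_arg ζ] at hz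
  have := lt_of_mul_lt_mul_left hz (norm_nonneg ζ)
  linarith

/-- A domain contained in a cone of opening `θ` with vertex `y` has an injective holomorphic map
to the disc with derivative at least `π / (2 θ |x - y|)` at the zero `x`. -/
lemma exists_discEmbedding_of_subset_planeCone {θ : ℝ} (hθ₁ : π ≤ θ) (hθ₂ : θ < 2 * π)
    {Ω : Set ℂ} {y v : ℂ} (hv : ‖v‖ = 1) (hsub : Ω ⊆ planeCone θ y v) {x : ℂ} (hx : x ∈ Ω) :
    ∃ k, DiscEmbedding Ω k ∧ k x = 0 ∧ π / (2 * θ) ≤ dist x y * ‖deriv k x‖ := by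
  have hθ : 0 < θ := Real.pi_pos.trans_le hθ₁
  set p : ℝ := π / θ with hp
  have hp0 : 0 < p := by positivity
  set ζ : ℂ → ℂ := fun z ↦ (z - y) * conj v with hζ
  set L : ℂ → ℂ := fun z ↦ p * Complex.log (ζ z) with hL
  set P : ℂ → ℂ := fun z ↦ Complex.exp (L z) with hP
  have hζ0 : ∀ z ∈ Ω, ζ z ≠ 0 := fun z hz ↦
    (abs_arg_lt_of_mem_planeCone hθ hv (hsub hz)).1
  have harg : ∀ z ∈ Ω, |(ζ z).arg| < θ / 2 := fun z hz ↦
    (abs_arg_lt_of_mem_planeCone hθ hv (hsub hz)).2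
  have hLim : ∀ z ∈ Ω, |(L z).im| < π / 2 := by
    intro z hz
    have h1 : (L z).im = p * (ζ z).arg := by simp [hL, Complex.log_im]
    rw [h1, abs_mul, abs_of_pos hp0]
    calc p * |(ζ z).arg| < p * (θ / 2) := mul_lt_mul_of_pos_left (harg z hz) hp0
      _ = π / 2 := by rw [hp]; field_simp
  have hPre : ∀ z ∈ Ω, 0 < (P z).re := by
    intro z hz
    rw [hP, Complex.exp_re]
    exact mul_pos (Real.exp_pos _) (Real.cos_pos_of_mem_Ioo (abs_lt.mp (hLim z hz)))
  have hPinj : InjOn P Ω := by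
    intro z hz w hw h
    have hz' := abs_lt.mp (hLim z hz)
    have hw' := abs_lt.mp (hLim w hw)
    have h1 : L z = L w := Complex.exp_inj_of_neg_pi_lt_of_le_pi (by linarith [Real.pi_pos])
      (by linarith [Real.pi_pos]) (by linarith [Real.pi_pos]) (by linarith [Real.pi_pos]) h
    have h2 : Complex.log (ζ z) = Complex.log (ζ w) :=
      mul_left_cancel₀ (by exact_mod_cast hp0.ne') h1
    have h3 : ζ z = ζ w := by
      rw [← Complex.exp_log (hζ0 z hz), h2, Complex.exp_log (hζ0 w hw)]
    have hv0 : conj v ≠ 0 := by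
      rw [← norm_ne_zero_iff, RCLike.norm_conj, hv]
      exact one_ne_zero
    exact sub_left_injective (mul_right_cancel₀ hv0 h3)
  have hPd : ∀ z ∈ Ω, HasDerivAt P (P z * (p * (conj v / ζ z))) z := by
    intro z hz
    have hslit : ζ z ∈ Complex.slitPlane := by
      rw [Complex.mem_slitPlane_iff_arg]
      refine ⟨fun h ↦ ?_, hζ0 z hz⟩
      have := harg z hz
      rw [h, abs_of_pos Real.pi_pos] at this
      linarith
    have h1 : HasDerivAt ζ (conj v) z := by
      simpa using ((hasDerivAt_id z).sub_const y).mul_const (conj v)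
    exact ((h1.clog hslit).const_mul (p : ℂ)).cexp
  have hden : ∀ z ∈ Ω, P z + conj (P x) ≠ 0 := by
    intro z hz h
    have h1 := congrArg Complex.re h
    simp only [Complex.add_re, Complex.conj_re, Complex.zero_re] at h1
    linarith [hPre z hz, hPre x hx]
  have hkd : ∀ z ∈ Ω, HasDerivAt (fun z ↦ (P z - P x) / (P z + conj (P x)))
      (P z * (p * (conj v / ζ z)) * (P x + conj (P x)) / (P z + conj (P x)) ^ 2) z := by
    intro z hz
    refine (((hPd z hz).sub_const _).div ((hPd z hz).add_const _) (hden z hz)).congr_deriv ?_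
    congr 1
    ring
  have hv0 : v ≠ 0 := by
    rw [← norm_ne_zero_iff, hv]
    exact one_ne_zero
  refine ⟨fun z ↦ (P z - P x) / (P z + conj (P x)), ⟨?_, ?_, ?_, ?_⟩, by simp, ?_⟩
  · exact fun z hz ↦ (hkd z hz).differentiableAt.differentiableWithinAt
  · intro z hz
    rw [mem_ball_zero_iff, norm_div, div_lt_one (norm_pos_iff.mpr (hden z hz)),
      ← sq_lt_sq₀ (norm_nonneg _) (norm_nonneg _), ← Complex.normSq_eq_norm_sq,
      ← Complex.normSq_eq_norm_sq, Complex.normSq_apply, Complex.normSq_apply]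
    simp only [Complex.sub_re, Complex.sub_im, Complex.add_re, Complex.add_im, Complex.conj_re,
      Complex.conj_im]
    nlinarith [mul_pos (hPre z hz) (hPre x hx)]
  · intro z hz w hw h
    rw [div_eq_div_iff (hden z hz) (hden w hw)] at h
    have h1 : (P x + conj (P x)) * (P z - P w) = 0 := by linear_combination h
    exact hPinj hz hw (sub_eq_zero.mp ((mul_eq_zero.mp h1).resolve_left (hden x hx)))
  · intro z hz
    rw [(hkd z hz).deriv]
    exact div_ne_zero (mul_ne_zero (mul_ne_zero (Complex.exp_ne_zero _) (mul_ne_zero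
      (by exact_mod_cast hp0.ne') (div_ne_zero (by simpa using hv0) (hζ0 z hz)))) (hden x hx))
      (pow_ne_zero _ (hden z hz))
  · rw [(hkd x hx).deriv]
    have hn : dist x y = ‖ζ x‖ := by
      rw [hζ, norm_mul, RCLike.norm_conj, hv, mul_one, dist_eq_norm]
    have hre : ‖P x + conj (P x)‖ = 2 * (P x).re := by
      rw [Complex.add_conj, Complex.norm_real, Real.norm_of_nonneg]
      linarith [hPre x hx]
    have h0 : 0 < ‖ζ x‖ := norm_pos_iff.mpr (hζ0 x hx)
    rw [norm_div, norm_mul, norm_mul, norm_mul, norm_div, norm_pow, hre, RCLike.norm_conj, hv, hn,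
      Complex.norm_real, Real.norm_of_nonneg hp0.le]
    have hP0 := hPre x hx
    have hle := Complex.re_le_norm (P x)
    have e : ‖ζ x‖ * (‖P x‖ * (p * (1 / ‖ζ x‖)) * (2 * (P x).re) / (2 * (P x).re) ^ 2) =
        p / 2 * (‖P x‖ / (P x).re) := by
      field_simp
    rw [e]
    have h1 : 1 ≤ ‖P x‖ / (P x).re := (one_le_div hP0).mpr hle
    have e2 : π / (2 * θ) = p / 2 := by rw [hp]; field_simp
    rw [e2]
    exact le_mul_of_one_le_right (by positivity) h1

/-- Lower bound for the hyperbolic density: under the exterior cone condition there are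
holomorphic maps to the disc whose pulled back Poincaré density is almost
`π / (2 θ d)` on a given compact set. -/
lemma exists_poincare_density_ge {θ : ℝ} (hθ₁ : π ≤ θ) (hθ₂ : θ < 2 * π) {Ω K : Set ℂ}
    (hΩ : IsOpen Ω) (hproper : Ω ≠ univ) (hsc : IsSimplyConnected Ω)
    (hcone : ∀ y ∈ frontier Ω, ∃ v : ℂ, ‖v‖ = 1 ∧ Ω ⊆ planeCone θ y v)
    (hK : IsCompact K) (hKΩ : K ⊆ Ω) {ε : ℝ} (hε₀ : 0 < ε) (hε₁ : ε < 1) :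
    ∃ f : ℂ → ℂ, DifferentiableOn ℂ f Ω ∧ MapsTo f Ω (ball 0 1) ∧ ∀ x ∈ K,
      (1 - ε) * (π / (2 * θ)) ≤ infDist x Ωᶜ * (‖deriv f x‖ / (1 - ‖f x‖ ^ 2)) := by
  have hmap : ∀ x ∈ Ω, ∃ k, DiscEmbedding Ω k ∧ k x = 0 ∧
      π / (2 * θ) ≤ infDist x Ωᶜ * ‖deriv k x‖ := by
    intro x hx
    obtain ⟨y, hy, hxy⟩ := exists_mem_frontier_infDist_compl_eq_dist hx hproper
    obtain ⟨v, hv, hsub⟩ := hcone y hy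
    rw [hxy]
    exact exists_discEmbedding_of_subset_planeCone hθ₁ hθ₂ hv hsub hx
  obtain ⟨x₀, hx₀⟩ := hsc.nonempty
  obtain ⟨k₀, hk₀, -⟩ := hmap x₀ hx₀
  obtain ⟨δ, hδ, hbound⟩ := exists_forall_norm_le_of_isCompact hΩ
    hsc.isPathConnected.isConnected.isPreconnected hx₀ hK hKΩ
  set ρ : ℝ := 1 - min δ (1 / 2) with hρ
  have hρ0 : 0 < ρ := by linarith [min_le_right δ (1 / 2)]
  have hρ1 : ρ < 1 := by linarith [lt_min hδ (by norm_num : (0 : ℝ) < 1 / 2)]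
  have hρ2 : ρ ^ 2 < 1 := by nlinarith
  set R : ℝ := √(ρ ^ 2 + (1 - ε) * (1 - ρ ^ 2)) with hR
  have hRsq : R ^ 2 = ρ ^ 2 + (1 - ε) * (1 - ρ ^ 2) := Real.sq_sqrt (by
    have := mul_pos (sub_pos.mpr hε₁) (sub_pos.mpr hρ2)
    positivity)
  have hR0 : 0 ≤ R := Real.sqrt_nonneg _
  have hρR : ρ < R := by
    have := mul_pos (sub_pos.mpr hε₁) (sub_pos.mpr hρ2)
    nlinarith
  have hR1 : R < 1 := by
    have := mul_pos hε₀ (sub_pos.mpr hρ2)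
    nlinarith
  obtain ⟨f, hf, hf0, hball⟩ := hk₀.exists_ball_subset_image hΩ hsc hx₀ (hρ0.trans hρR) hR1
  refine ⟨f, hf.differentiableOn, hf.mapsTo, fun x hx ↦ ?_⟩
  have hfx : ‖f x‖ ≤ ρ := by
    have := hbound f hf.differentiableOn hf.mapsTo hf0 x hx
    linarith [min_le_left δ (1 / 2)]
  obtain ⟨k, hk, hkx, hkd⟩ := hmap x (hKΩ hx)
  have hcmp := hf.norm_deriv_le_of_ball_subset_image hΩ (hρ0.trans hρR) hball hk.differentiableOn
    hk.mapsTo (hKΩ hx) hkx (hfx.trans_lt hρR)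
  have hfsq : ‖f x‖ ^ 2 ≤ ρ ^ 2 := by gcongr
  have hpos : 0 < 1 - ‖f x‖ ^ 2 := by linarith
  have h1 : (1 - ε) * (1 - ‖f x‖ ^ 2) ≤ R ^ 2 - ‖f x‖ ^ 2 := by
    rw [hRsq]
    nlinarith
  have h2 : ‖deriv k x‖ * ((1 - ε) * (1 - ‖f x‖ ^ 2)) ≤ ‖deriv f x‖ := by
    have h3 := mul_le_mul_of_nonneg_left h1 (norm_nonneg (deriv k x))
    have h4 : ‖deriv f x‖ * R ≤ ‖deriv f x‖ := mul_le_of_le_one_right (norm_nonneg _) hR1.le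
    linarith
  have h3 : (1 - ε) * ‖deriv k x‖ ≤ ‖deriv f x‖ / (1 - ‖f x‖ ^ 2) := by
    rw [le_div_iff₀ hpos]
    linarith
  calc (1 - ε) * (π / (2 * θ)) ≤ (1 - ε) * (infDist x Ωᶜ * ‖deriv k x‖) :=
        mul_le_mul_of_nonneg_left hkd (by linarith)
    _ = infDist x Ωᶜ * ((1 - ε) * ‖deriv k x‖) := by ring
    _ ≤ _ := mul_le_mul_of_nonneg_left h3 infDist_nonneg

lemma integrable_mul_of_tsupport_subset {Ω : Set ℂ} (hΩ : IsOpen Ω) {w g : ℂ → ℝ}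
    (hw : Continuous w) (hc : HasCompactSupport w) (hs : tsupport w ⊆ Ω)
    (hg : ContinuousOn g Ω) : Integrable (fun z ↦ w z * g z) :=
  Continuous.integrable_of_hasCompactSupport
    ((hw.continuousOn.mul hg).continuous_of_tsupport_subset hΩ
      ((tsupport_mul_subset_left).trans hs)) hc.mul_right

lemma sq_fderiv_one_add_sq_fderiv_I_le (L : ℂ →L[ℝ] ℝ) : L 1 ^ 2 + L Complex.I ^ 2 ≤ ‖L‖ ^ 2 := by
  set c : ℂ := ⟨L 1, L Complex.I⟩ with hc
  have h1 : c = L 1 • (1 : ℂ) + L Complex.I • Complex.I := by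
    apply Complex.ext <;> simp [hc]
  have h2 : L c = L 1 ^ 2 + L Complex.I ^ 2 := by
    rw [h1, map_add, map_smul, map_smul, smul_eq_mul, smul_eq_mul]
    ring
  have h3 : ‖c‖ ^ 2 = L 1 ^ 2 + L Complex.I ^ 2 := by
    rw [← Complex.normSq_eq_norm_sq, Complex.normSq_apply]
    ring
  have h4 := (le_abs_self _).trans (L.le_opNorm c)
  rw [h2, ← h3] at h4
  rw [← h3]
  rcases (norm_nonneg c).eq_or_lt with h0 | h0
  · rw [← h0]
    simp
  · have h5 : ‖c‖ ≤ ‖L‖ := by nlinarith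
    gcongr

section PoincareField

variable {Ω : Set ℂ} {f : ℂ → ℂ}

/-- Minus the complex derivative of `log (1 - |f|²)`; its real and imaginary parts are,
up to sign, the components of half the gradient of that logarithm. -/
noncomputable def poincareField (f : ℂ → ℂ) (z : ℂ) : ℂ :=
  conj (f z) * deriv f z / (1 - conj (f z) * f z)

/-- The directional derivative of `poincareField f` in the direction `v`. -/
noncomputable def poincareFieldDeriv (f : ℂ → ℂ) (v z : ℂ) : ℂ :=
  (conj (deriv f z * v) * deriv f z + (conj (f z) * deriv (deriv f) z * (1 - conj (f z) * f z) +
    (conj (f z) * deriv f z) ^ 2) * v) / (1 - conj (f z) * f z) ^ 2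

lemma hasLineDerivAt_poincareField (hΩ : IsOpen Ω) (hf : DifferentiableOn ℂ f Ω)
    (hm : MapsTo f Ω (ball 0 1)) {z : ℂ} (hz : z ∈ Ω) (v : ℂ) :
    HasLineDerivAt ℝ (poincareField f) (poincareFieldDeriv f v z) z v := by
  have hline : ∀ g : ℂ → ℂ, DifferentiableAt ℂ g z →
      HasDerivAt (fun t : ℝ ↦ g (z + t • v)) (deriv g z * v) 0 := by
    intro g hg
    have h1 : HasDerivAt (fun t : ℝ ↦ z + t • v) v 0 := by
      simpa using ((hasDerivAt_id (0 : ℝ)).smul_const v).const_add z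
    have h2 : HasDerivAt g (deriv g z) (z + (0 : ℝ) • v) := by simpa using hg.hasDerivAt
    exact h2.comp (0 : ℝ) h1
  have hfz := hline f (hf.differentiableAt (hΩ.mem_nhds hz))
  have hdz := hline (deriv f) ((hf.deriv hΩ).differentiableAt (hΩ.mem_nhds hz))
  have hconj : HasDerivAt (fun t : ℝ ↦ conj (f (z + t • v))) (conj (deriv f z * v)) 0 :=
    hfz.star
  have hfn : ‖f z‖ < 1 := mem_ball_zero_iff.mp (hm hz)
  have hne : 1 - conj (f (z + (0 : ℝ) • v)) * f (z + (0 : ℝ) • v) ≠ 0 := by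
    simpa using mobius_denom_ne_zero hfn hfn
  refine ((hconj.mul hdz).div ((hconj.mul hfz).const_sub 1) hne).congr_deriv ?_
  simp only [Pi.mul_apply, zero_smul, add_zero, poincareFieldDeriv]
  congr 1
  ring

lemma poincareField_denom (w : ℂ) : 1 - conj w * w = ((1 - ‖w‖ ^ 2 : ℝ) : ℂ) := by
  rw [Complex.conj_mul']
  push_cast
  rfl

lemma poincareFieldDeriv_divergence (z : ℂ) :
    (poincareFieldDeriv f Complex.I z).im - (poincareFieldDeriv f 1 z).re =
      -(2 * (‖deriv f z‖ / (1 - ‖f z‖ ^ 2)) ^ 2) := by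
  have h1 : (‖deriv f z‖ / (1 - ‖f z‖ ^ 2)) ^ 2 =
      ((deriv f z).re * (deriv f z).re + (deriv f z).im * (deriv f z).im) /
        (1 - ‖f z‖ ^ 2) ^ 2 := by
    rw [div_pow, ← Complex.normSq_eq_norm_sq (deriv f z), Complex.normSq_apply]
  rw [h1, poincareFieldDeriv, poincareFieldDeriv, poincareField_denom, ← Complex.ofReal_pow,
    Complex.div_ofReal_im, Complex.div_ofReal_re, ← sub_div, mul_div_assoc', ← neg_div]
  congr 1
  simp
  ring

lemma sq_norm_poincareField_le (hm : MapsTo f Ω (ball 0 1)) {z : ℂ} (hz : z ∈ Ω) :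
    (poincareField f z).re ^ 2 + (poincareField f z).im ^ 2 ≤
      (‖deriv f z‖ / (1 - ‖f z‖ ^ 2)) ^ 2 := by
  have hfn : ‖f z‖ < 1 := mem_ball_zero_iff.mp (hm hz)
  have hpos : 0 < 1 - ‖f z‖ ^ 2 := by nlinarith [norm_nonneg (f z)]
  have h1 : (poincareField f z).re ^ 2 + (poincareField f z).im ^ 2 = ‖poincareField f z‖ ^ 2 := by
    rw [← Complex.normSq_eq_norm_sq, Complex.normSq_apply]
    ring
  rw [h1, poincareField, poincareField_denom, norm_div, norm_mul, RCLike.norm_conj,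
    Complex.norm_real, Real.norm_of_nonneg hpos.le]
  have : ‖f z‖ * ‖deriv f z‖ ≤ ‖deriv f z‖ := mul_le_of_le_one_left (norm_nonneg _) hfn.le
  gcongr

lemma continuousOn_poincareField (hΩ : IsOpen Ω) (hf : DifferentiableOn ℂ f Ω)
    (hm : MapsTo f Ω (ball 0 1)) : ContinuousOn (poincareField f) Ω := by
  have h0 := hf.continuousOn
  have h1 := (hf.deriv hΩ).continuousOn
  have hc : ContinuousOn (fun z ↦ conj (f z)) Ω := Complex.continuous_conj.comp_continuousOn h0
  refine (hc.mul h1).div (continuousOn_const.sub (hc.mul h0)) fun z hz ↦ ?_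
  have hfn : ‖f z‖ < 1 := mem_ball_zero_iff.mp (hm hz)
  exact mobius_denom_ne_zero hfn hfn

lemma continuousOn_poincareFieldDeriv (hΩ : IsOpen Ω) (hf : DifferentiableOn ℂ f Ω)
    (hm : MapsTo f Ω (ball 0 1)) (v : ℂ) : ContinuousOn (poincareFieldDeriv f v) Ω := by
  have h0 := hf.continuousOn
  have h1 := (hf.deriv hΩ).continuousOn
  have h2 := ((hf.deriv hΩ).deriv hΩ).continuousOn
  have hc : ContinuousOn (fun z ↦ conj (f z)) Ω := Complex.continuous_conj.comp_continuousOn h0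
  have hc1 : ContinuousOn (fun z ↦ conj (deriv f z * v)) Ω :=
    Complex.continuous_conj.comp_continuousOn (h1.mul continuousOn_const)
  have hd : ContinuousOn (fun z ↦ 1 - conj (f z) * f z) Ω := continuousOn_const.sub (hc.mul h0)
  refine ((hc1.mul h1).add ((((hc.mul h2).mul hd).add ((hc.mul h1).pow 2)).mul
    continuousOn_const)).div (hd.pow 2) fun z hz ↦ ?_
  have hfn : ‖f z‖ < 1 := mem_ball_zero_iff.mp (hm hz)
  exact pow_ne_zero _ (mobius_denom_ne_zero hfn hfn)

lemma continuousOn_poincareDensity (hΩ : IsOpen Ω) (hf : DifferentiableOn ℂ f Ω)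
    (hm : MapsTo f Ω (ball 0 1)) :
    ContinuousOn (fun z ↦ (‖deriv f z‖ / (1 - ‖f z‖ ^ 2)) ^ 2) Ω := by
  refine ((hf.deriv hΩ).continuousOn.norm.div
    (continuousOn_const.sub (hf.continuousOn.norm.pow 2)) fun z hz ↦ ?_).pow 2
  have hfn : ‖f z‖ < 1 := mem_ball_zero_iff.mp (hm hz)
  have hpos : 0 < 1 - ‖f z‖ ^ 2 := by nlinarith [norm_nonneg (f z)]
  exact hpos.ne'

variable {u : ℂ → ℝ}

/-- Integration by parts against a function differentiable near the support. -/
lemma integral_sq_mul_lineDeriv (hΩ : IsOpen Ω) (hu : ContDiff ℝ 1 u) (hc : HasCompactSupport u)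
    (hs : tsupport u ⊆ Ω) {X Y : ℂ → ℝ} {v : ℂ} (hX : ContinuousOn X Ω) (hY : ContinuousOn Y Ω)
    (hd : ∀ z ∈ Ω, HasLineDerivAt ℝ X (Y z) z v) :
    ∫ z, u z ^ 2 * Y z = -∫ z, 2 * u z * fderiv ℝ u z v * X z := by
  have hsq : HasCompactSupport fun z ↦ u z ^ 2 := by
    simp_rw [sq]
    exact hc.mul_right
  have hsqs : tsupport (fun z ↦ u z ^ 2) ⊆ Ω := by
    simp_rw [sq]
    exact (tsupport_mul_subset_left).trans hs
  have hduc : Continuous fun z ↦ fderiv ℝ u z v :=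
    (hu.continuous_fderiv one_ne_zero).clm_apply continuous_const
  have hw : HasCompactSupport fun z ↦ 2 * u z * fderiv ℝ u z v := by
    simp_rw [mul_comm (2 : ℝ), mul_assoc]
    exact hc.mul_right
  have hws : tsupport (fun z ↦ 2 * u z * fderiv ℝ u z v) ⊆ Ω := by
    simp_rw [mul_comm (2 : ℝ), mul_assoc]
    exact (tsupport_mul_subset_left).trans hs
  refine integral_bilinear_hasLineDerivAt_right_eq_neg_left_of_integrable
    (B := ContinuousLinearMap.mul ℝ ℝ) (f := fun z ↦ u z ^ 2) (g := X) (v := v) ?_ ?_ ?_ ?_ ?_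
  · exact integrable_mul_of_tsupport_subset hΩ ((hu.continuous.const_mul 2).mul hduc) hw hws hX
  · exact integrable_mul_of_tsupport_subset hΩ (hu.continuous.pow 2) hsq hsqs hY
  · exact integrable_mul_of_tsupport_subset hΩ (hu.continuous.pow 2) hsq hsqs hX
  · intro z _
    have h1 := ((hu.differentiable one_ne_zero).differentiableAt (x := z)).hasFDerivAt.hasLineDerivAt v
    have h2 := HasDerivAt.pow (n := 2) h1
    refine h2.congr_deriv ?_
    simp
  · exact fun z hz ↦ hd z (hsqs hz)

/-- Hardy's inequality for the pull back of the Poincaré metric of the disc. -/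
lemma integral_sq_mul_poincareDensity_le (hΩ : IsOpen Ω) (hf : DifferentiableOn ℂ f Ω)
    (hm : MapsTo f Ω (ball 0 1)) (hu : ContDiff ℝ 1 u) (hc : HasCompactSupport u)
    (hs : tsupport u ⊆ Ω) :
    ∫ z, u z ^ 2 * (‖deriv f z‖ / (1 - ‖f z‖ ^ 2)) ^ 2 ≤ ∫ z, ‖fderiv ℝ u z‖ ^ 2 := by
  have hsq : HasCompactSupport fun z ↦ u z ^ 2 := by
    simp_rw [sq]
    exact hc.mul_right
  have hsqs : tsupport (fun z ↦ u z ^ 2) ⊆ Ω := by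
    simp_rw [sq]
    exact (tsupport_mul_subset_left).trans hs
  have hduc : ∀ v, Continuous fun z ↦ fderiv ℝ u z v := fun v ↦
    (hu.continuous_fderiv one_ne_zero).clm_apply continuous_const
  have hB := continuousOn_poincareField hΩ hf hm
  have hB' := continuousOn_poincareFieldDeriv hΩ hf hm
  have hre : ContinuousOn (fun z ↦ (poincareField f z).re) Ω :=
    Complex.continuous_re.comp_continuousOn hB
  have him : ContinuousOn (fun z ↦ (poincareField f z).im) Ω :=
    Complex.continuous_im.comp_continuousOn hB
  have hre' : ContinuousOn (fun z ↦ (poincareFieldDeriv f 1 z).re) Ω :=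
    Complex.continuous_re.comp_continuousOn (hB' 1)
  have him' : ContinuousOn (fun z ↦ (poincareFieldDeriv f Complex.I z).im) Ω :=
    Complex.continuous_im.comp_continuousOn (hB' Complex.I)
  have hibp1 := integral_sq_mul_lineDeriv hΩ hu hc hs hre hre' fun z hz ↦
    Complex.reCLM.hasFDerivAt.comp_hasDerivAt (0 : ℝ) (hasLineDerivAt_poincareField hΩ hf hm hz 1)
  have hibp2 := integral_sq_mul_lineDeriv hΩ hu hc hs him him' fun z hz ↦
    Complex.imCLM.hasFDerivAt.comp_hasDerivAt (0 : ℝ)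
      (hasLineDerivAt_poincareField hΩ hf hm hz Complex.I)
  have hI : ∀ {g : ℂ → ℝ}, ContinuousOn g Ω → Integrable fun z ↦ u z ^ 2 * g z := fun hg ↦
    integrable_mul_of_tsupport_subset hΩ (hu.continuous.pow 2) hsq hsqs hg
  have hJ : ∀ v, ∀ {g : ℂ → ℝ}, ContinuousOn g Ω →
      Integrable fun z ↦ 2 * u z * fderiv ℝ u z v * g z := by
    intro v g hg
    have := integrable_mul_of_tsupport_subset hΩ hu.continuous hc hs
      ((continuous_const.mul (hduc v)).continuousOn.mul hg : ContinuousOn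
        (fun z ↦ 2 * fderiv ℝ u z v * g z) Ω)
    refine this.congr (.of_forall fun z ↦ ?_)
    simp only [Pi.mul_apply]
    ring
  have hdens := hI (continuousOn_poincareDensity hΩ hf hm)
  have hgrad : Integrable fun z ↦ ‖fderiv ℝ u z‖ ^ 2 := by
    refine Continuous.integrable_of_hasCompactSupport
      ((hu.continuous_fderiv one_ne_zero).norm.pow 2) ?_
    simp_rw [sq]
    exact (hc.fderiv ℝ).norm.mul_right
  have hkey : ∫ z, 2 * (u z ^ 2 * (‖deriv f z‖ / (1 - ‖f z‖ ^ 2)) ^ 2) =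
      ∫ z, (2 * u z * fderiv ℝ u z Complex.I * (poincareField f z).im -
        2 * u z * fderiv ℝ u z 1 * (poincareField f z).re) := by
    rw [integral_sub (hJ _ him) (hJ _ hre)]
    have h1 : ∫ z, 2 * (u z ^ 2 * (‖deriv f z‖ / (1 - ‖f z‖ ^ 2)) ^ 2) =
        ∫ z, (u z ^ 2 * (poincareFieldDeriv f 1 z).re -
          u z ^ 2 * (poincareFieldDeriv f Complex.I z).im) := by
      congr 1
      ext z
      linear_combination u z ^ 2 * poincareFieldDeriv_divergence (f := f) z
    rw [h1, integral_sub (hI hre') (hI him'), hibp1, hibp2]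
    ring
  have hle : ∫ z, (2 * u z * fderiv ℝ u z Complex.I * (poincareField f z).im -
        2 * u z * fderiv ℝ u z 1 * (poincareField f z).re) ≤
      ∫ z, (‖fderiv ℝ u z‖ ^ 2 + u z ^ 2 * (‖deriv f z‖ / (1 - ‖f z‖ ^ 2)) ^ 2) := by
    refine integral_mono ((hJ _ him).sub (hJ _ hre)) (hgrad.add hdens) fun z ↦ ?_
    have h1 := sq_fderiv_one_add_sq_fderiv_I_le (fderiv ℝ u z)
    by_cases hz : z ∈ Ω
    · have h2 := mul_le_mul_of_nonneg_left (sq_norm_poincareField_le hm hz) (sq_nonneg (u z))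
      simp only
      nlinarith [sq_nonneg (fderiv ℝ u z Complex.I - u z * (poincareField f z).im),
        sq_nonneg (fderiv ℝ u z 1 + u z * (poincareField f z).re)]
    · have hu0 : u z = 0 := image_eq_zero_of_notMem_tsupport fun h ↦ hz (hs h)
      simp [hu0]
  rw [integral_const_mul] at hkey
  rw [integral_add hgrad hdens] at hle
  linarith

end PoincareField

/-- The planar Hardy inequality under the exterior cone condition, in complex notation. -/
theorem hardy_planeCone {θ : ℝ} (hθ₁ : π ≤ θ) (hθ₂ : θ < 2 * π) {Ω : Set ℂ}
    (hΩ : IsOpen Ω) (hproper : Ω ≠ univ) (hsc : IsSimplyConnected Ω)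
    (hcone : ∀ y ∈ frontier Ω, ∃ v : ℂ, ‖v‖ = 1 ∧ Ω ⊆ planeCone θ y v)
    {u : ℂ → ℝ} (hu : ContDiff ℝ 1 u) (hc : HasCompactSupport u) (hs : tsupport u ⊆ Ω) :
    π ^ 2 / (4 * θ ^ 2) * ∫ z in Ω, u z ^ 2 / infDist z Ωᶜ ^ 2 ≤
      ∫ z in Ω, ‖fderiv ℝ u z‖ ^ 2 := by
  have hu0 : ∀ z, z ∉ tsupport u → u z = 0 := fun z hz ↦ image_eq_zero_of_notMem_tsupport hz
  rw [setIntegral_eq_integral_of_forall_compl_eq_zero fun z hz ↦ by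
      simp [hu0 z fun h ↦ hz (hs h)],
    setIntegral_eq_integral_of_forall_compl_eq_zero fun z hz ↦ by
      have h1 : fderiv ℝ u z = 0 :=
        image_eq_zero_of_notMem_tsupport fun h ↦ hz (hs (tsupport_fderiv_subset ℝ h))
      simp [h1]]
  set A := ∫ z, u z ^ 2 / infDist z Ωᶜ ^ 2
  set G := ∫ z, ‖fderiv ℝ u z‖ ^ 2
  have hsq : HasCompactSupport fun z ↦ u z ^ 2 := by
    simp_rw [sq]
    exact hc.mul_right
  have hsqs : tsupport (fun z ↦ u z ^ 2) ⊆ Ω := by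
    simp_rw [sq]
    exact (tsupport_mul_subset_left).trans hs
  have happrox : ∀ ε ∈ Ioo (0 : ℝ) 1, (1 - ε) ^ 2 * (π ^ 2 / (4 * θ ^ 2) * A) ≤ G := by
    rintro ε ⟨hε₀, hε₁⟩
    obtain ⟨f, hf, hm, hfK⟩ := exists_poincare_density_ge hθ₁ hθ₂ hΩ hproper hsc hcone hc hs
      hε₀ hε₁
    refine le_trans ?_ (integral_sq_mul_poincareDensity_le hΩ hf hm hu hc hs)
    rw [← mul_assoc, ← integral_const_mul]
    refine integral_mono_of_nonneg (.of_forall fun z ↦ by positivity)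
      (integrable_mul_of_tsupport_subset hΩ (hu.continuous.pow 2) hsq hsqs
        (continuousOn_poincareDensity hΩ hf hm)) (.of_forall fun z ↦ ?_)
    by_cases hz : z ∈ tsupport u
    · have hd : 0 < infDist z Ωᶜ :=
        (hΩ.isClosed_compl.notMem_iff_infDist_pos (nonempty_compl.mpr hproper)).mp
          fun h ↦ h (hs hz)
      have h1 := hfK z hz
      have h0 : 0 ≤ (1 - ε) * (π / (2 * θ)) :=
        mul_nonneg (by linarith) (div_nonneg Real.pi_pos.le (by linarith [Real.pi_pos]))
      have h2 := pow_le_pow_left₀ h0 h1 2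
      have h3 : (1 - ε) ^ 2 * (π ^ 2 / (4 * θ ^ 2)) = ((1 - ε) * (π / (2 * θ))) ^ 2 := by ring
      simp only
      rw [h3, mul_div_assoc', div_le_iff₀ (by positivity)]
      calc ((1 - ε) * (π / (2 * θ))) ^ 2 * u z ^ 2 ≤ _ :=
            mul_le_mul_of_nonneg_right h2 (sq_nonneg (u z))
        _ = _ := by ring
    · simp [hu0 z hz]
  have hlim : Filter.Tendsto (fun ε : ℝ ↦ (1 - ε) ^ 2 * (π ^ 2 / (4 * θ ^ 2) * A)) (𝓝[>] 0)
      (𝓝 ((1 - 0) ^ 2 * (π ^ 2 / (4 * θ ^ 2) * A))) :=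
    tendsto_nhdsWithin_of_tendsto_nhds (Continuous.tendsto (by fun_prop) 0)
  rw [sub_zero, one_pow, one_mul] at hlim
  refine le_of_tendsto hlim ?_
  filter_upwards [Ioo_mem_nhdsGT one_pos] with ε hε using happrox ε hε

/-- **Laptev–Sobolev theorem.**
Let `θ ∈ [π, 2π)` and let `Ω ⊊ ℝ²` be a nonempty open simply connected set such that
every boundary point `y` is the vertex of an open infinite cone of opening angle `θ`
containing `Ω`.  Then `∫_Ω ‖∇u‖² ≥ (π²/(4θ²)) ∫_Ω u²/d²` for all `u ∈ C_c^∞(Ω)`. -/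
theorem hardy_exterior_cone_condition
    (θ : ℝ) (hθ₁ : Real.pi ≤ θ) (hθ₂ : θ < 2 * Real.pi)
    (Ω : Set (EuclideanSpace ℝ (Fin 2)))
    (hopen : IsOpen Ω) (hne : Ω.Nonempty) (hproper : Ω ≠ Set.univ)
    (hsc : SimplyConnectedSpace Ω)
    (hcone : ∀ y ∈ frontier Ω, ∃ v : EuclideanSpace ℝ (Fin 2), ‖v‖ = 1 ∧
      Ω ⊆ {x : EuclideanSpace ℝ (Fin 2) |
        x ≠ y ∧ ‖x - y‖ * Real.cos (θ / 2) < ⟪x - y, v⟫})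
    (u : EuclideanSpace ℝ (Fin 2) → ℝ)
    (hu : ContDiff ℝ (⊤ : ℕ∞) u) (hcpt : HasCompactSupport u) (hsupp : tsupport u ⊆ Ω) :
    Real.pi ^ 2 / (4 * θ ^ 2) * ∫ x in Ω, u x ^ 2 / Metric.infDist x Ωᶜ ^ 2
      ≤ ∫ x in Ω, ‖gradient u x‖ ^ 2 := by
  let e : ℂ ≃ₗᵢ[ℝ] EuclideanSpace ℝ (Fin 2) := Complex.orthonormalBasisOneI.repr
  have hmp : MeasurePreserving e volume volume := e.measurePreserving
  have hemb : MeasurableEmbedding e := e.toHomeomorph.measurableEmbedding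
  have hmain := hardy_planeCone (Ω := e ⁻¹' Ω) (u := u ∘ e) hθ₁ hθ₂
    (hopen.preimage e.continuous) ?_ ?_ ?_ ?_ ?_ ?_
  · have h1 : ∀ z, infDist z (e ⁻¹' Ω)ᶜ = infDist (e z) Ωᶜ := by
      intro z
      rw [← preimage_compl, ← infDist_image e.isometry, image_preimage_eq _ e.surjective]
    have h2 : ∀ z, ‖fderiv ℝ (u ∘ e) z‖ = ‖gradient u (e z)‖ := by
      intro z
      have hd : HasFDerivAt (u ∘ e) ((fderiv ℝ u (e z)).comp (e : ℂ →L[ℝ] _)) z :=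
        ((hu.differentiable (by simp)) (e z)).hasFDerivAt.comp z e.toContinuousLinearEquiv.hasFDerivAt
      rw [hd.fderiv, gradient, LinearIsometryEquiv.norm_map]
      exact ContinuousLinearMap.opNorm_comp_linearIsometryEquiv _ e
    simp_rw [h1, h2, Function.comp_apply] at hmain
    rw [hmp.setIntegral_preimage_emb hemb (fun x ↦ u x ^ 2 / infDist x Ωᶜ ^ 2),
      hmp.setIntegral_preimage_emb hemb (fun x ↦ ‖gradient u x‖ ^ 2)] at hmain
    exact hmain
  · intro h
    exact hproper (by rw [← image_preimage_eq Ω e.surjective, h, image_univ, e.range_eq_univ])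
  · exact e.toHomeomorph.isSimplyConnected_preimage.mpr hsc
  · intro y hy
    have hy' : e y ∈ frontier Ω := by
      have h := e.toHomeomorph.preimage_frontier Ω
      exact h.ge hy
    obtain ⟨v, hv, hsub⟩ := hcone (e y) hy'
    refine ⟨e.symm v, by simpa using hv, fun z hz ↦ ?_⟩
    obtain ⟨h1, h2⟩ := hsub hz
    refine ⟨fun h ↦ h1 (by rw [h]), ?_⟩
    have h3 : ⟪e z - e y, v⟫ = ((z - y) * conj (e.symm v)).re := by
      rw [← map_sub, ← e.apply_symm_apply v, e.inner_map_map, e.symm_apply_apply, Complex.inner]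
      rw [← Complex.conj_re, map_mul, Complex.conj_conj, mul_comm, mul_comm]
    rwa [h3, ← map_sub, e.norm_map] at h2
  · exact (hu.of_le (by exact_mod_cast le_top)).comp e.contDiff
  · exact hcpt.comp_homeomorph e.toHomeomorph
  · have h : tsupport (u ∘ e) = e ⁻¹' tsupport u := tsupport_comp_eq_preimage u e.toHomeomorph
    exact h.le.trans (preimage_mono hsupp)
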